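/- Under the assumptions of the strongly-convex SNAG scheme with strong growth constant ρ, starting from x_0 = z_0, the iterates satisfy E[f(x_n) − f*] ≤ 2(1 − (1/ρ)√(μ/L))^n (f(x_0) − f*). Consequently, for any ε > 0, if n ≥ ρ√(L/μ)·log(2(f(x_0) − f*)/ε) then E[f(x_n) − f*] ≤ ε. -/

import Mathlib

open MeasureTheory RealInnerProductSpace

section aux
variable {E : Type*} [NormedAddCommGroup E] [InnerProductSpace ℝ E] [CompleteSpace E]

lemma line_deriv (f : E → ℝ) (hdiff : Differentiable ℝ f) (y v : E) (t : ℝ) :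
    HasDerivAt (fun t : ℝ => f (y + t • v)) ⟪gradient f (y + t • v), v⟫ t := by
  have h1 : HasDerivAt (fun t : ℝ => y + t • v) v t := by
    simpa using ((hasDerivAt_id t).smul_const v).const_add y
  have h2 := (hdiff (y + t • v)).hasFDerivAt.comp_hasDerivAt t h1
  rw [inner_gradient_left]
  exact h2

lemma descent (f : E → ℝ) (L : ℝ) (hdiff : Differentiable ℝ f)
    (hsmooth : ∀ x y : E, ‖gradient f x - gradient f y‖ ≤ L * ‖x - y‖) (y v : E) :
    f (y + v) ≤ f y + ⟪gradient f y, v⟫ + L / 2 * ‖v‖ ^ 2 := by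
  set h : ℝ → ℝ := fun t => f (y + t • v) - t * ⟪gradient f y, v⟫ - t ^ 2 * (L / 2 * ‖v‖ ^ 2)
    with hh
  have hd : ∀ t, HasDerivAt h (⟪gradient f (y + t • v), v⟫ - ⟪gradient f y, v⟫
      - 2 * t * (L / 2 * ‖v‖ ^ 2)) t := by
    intro t
    have h1 := ((line_deriv f hdiff y v t).sub
      ((hasDerivAt_id t).mul_const ⟪gradient f y, v⟫)).sub
      ((hasDerivAt_pow 2 t).mul_const (L / 2 * ‖v‖ ^ 2))
    refine HasDerivAt.congr_deriv h1 ?_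
    norm_num
  have hanti : AntitoneOn h (Set.Icc 0 1) := by
    apply antitoneOn_of_deriv_nonpos (convex_Icc 0 1)
    · exact fun t _ => (hd t).continuousAt.continuousWithinAt
    · exact fun t _ => (hd t).differentiableAt.differentiableWithinAt
    · intro t ht
      rw [interior_Icc] at ht
      rw [(hd t).deriv, ← inner_sub_left]
      have h1 := real_inner_le_norm (gradient f (y + t • v) - gradient f y) v
      have h2 := hsmooth (y + t • v) y
      rw [add_sub_cancel_left, norm_smul, Real.norm_of_nonneg ht.1.le] at h2
      have h3 := mul_le_mul_of_nonneg_right h2 (norm_nonneg v)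
      nlinarith
  have := hanti (Set.left_mem_Icc.2 zero_le_one) (Set.right_mem_Icc.2 zero_le_one) zero_le_one
  simp only [hh, one_smul, zero_smul, add_zero] at this
  linarith

lemma strong_first (f : E → ℝ) (μ : ℝ) (hdiff : Differentiable ℝ f)
    (hsc : StrongConvexOn Set.univ μ f) (y x : E) :
    f y + ⟪gradient f y, x - y⟫ + μ / 2 * ‖x - y‖ ^ 2 ≤ f x := by
  have hd := line_deriv f hdiff y (x - y) 0
  simp only [zero_smul, add_zero] at hd
  have ht := hd.tendsto_slope_zero_right
  simp only [zero_add, zero_smul, add_zero] at ht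
  have ht2 : Filter.Tendsto (fun t : ℝ => f x - f y - μ / 2 * (1 - t) * ‖x - y‖ ^ 2)
      (nhdsWithin 0 (Set.Ioi 0)) (nhds (f x - f y - μ / 2 * (1 - 0) * ‖x - y‖ ^ 2)) := by
    apply Filter.Tendsto.mono_left _ nhdsWithin_le_nhds
    apply Continuous.tendsto (f := fun t : ℝ => f x - f y - μ / 2 * (1 - t) * ‖x - y‖ ^ 2)
    fun_prop
  have := le_of_tendsto_of_tendsto ht ht2 (by
    filter_upwards [Ioo_mem_nhdsGT (zero_lt_one (α := ℝ))] with t ht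
    have h := hsc.2 (Set.mem_univ y) (Set.mem_univ x) (sub_nonneg.2 ht.2.le) ht.1.le
      (by ring)
    have e : (1 - t) • y + t • x = y + t • (x - y) := by module
    rw [e, norm_sub_rev y x] at h
    simp only [smul_eq_mul] at h ⊢
    rw [inv_mul_le_iff₀ ht.1]
    linarith)
  linarith

lemma step_ineq (fx fy fs fx' μ L q s η ρ : ℝ) (hμ : 0 ≤ μ) (hq : 0 ≤ q) (hq1 : q ≤ 1)
    (e1 : μ * η = q) (e2 : μ * η ^ 2 = L * s ^ 2) (e3 : s = ρ * (L * s ^ 2))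
    (u v g G : E)
    (h1 : fx' ≤ fy + ⟪g, -(s • G)⟫ + L / 2 * ‖-(s • G)‖ ^ 2)
    (h2 : fy + ⟪g, -(q • (u - v))⟫ ≤ fx)
    (h3 : fy + ⟪g, -v⟫ + μ / 2 * ‖-v‖ ^ 2 ≤ fs) :
    fx' - fs + μ / 2 * ‖(1 - q) • u + q • v - η • G‖ ^ 2 ≤
      (1 - q) * (fx - fs + μ / 2 * ‖u‖ ^ 2)
      + ⟪-(s • g) - q • ((1 - q) • u + q • v), G - g⟫
      + L * s ^ 2 * (‖G‖ ^ 2 - ρ * ‖g‖ ^ 2) := by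
  have h4 : 0 ≤ μ / 2 * (q * (1 - q)) * ‖u - v‖ ^ 2 := by
    have : 0 ≤ 1 - q := by linarith
    positivity
  have h2' := mul_le_mul_of_nonneg_left h2 (sub_nonneg.2 hq1)
  have h3' := mul_le_mul_of_nonneg_left h3 hq
  simp only [← real_inner_self_eq_norm_sq, inner_sub_left, inner_sub_right, inner_add_left,
    inner_add_right, inner_neg_left, inner_neg_right, real_inner_smul_left,
    real_inner_smul_right] at *
  rw [real_inner_comm u v] at h4
  simp only [real_inner_comm u v, real_inner_comm u G, real_inner_comm v G, real_inner_comm u g,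
    real_inner_comm v g] at *
  linear_combination h1 + h2' + h3' + h4 - ((1 - q) * ⟪u, G⟫ + q * ⟪v, G⟫) * e1
    + ⟪G, G⟫ / 2 * e2 - ⟪g, g⟫ * e3
end aux

lemma integrable_inner_aux {Ω : Type*} {m0 : MeasurableSpace Ω} (P : Measure Ω)
    {E : Type*} [NormedAddCommGroup E] [InnerProductSpace ℝ E]
    (A B : Ω → E) (hA : MemLp A 2 P) (hB : MemLp B 2 P) :
    Integrable (fun ω => ⟪A ω, B ω⟫) P := by
  have hA2 := hA.integrable_norm_pow (by norm_num)
  have hB2 := hB.integrable_norm_pow (by norm_num)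
  refine Integrable.mono' (hA2.add hB2) (hA.1.inner hB.1) (Filter.Eventually.of_forall fun ω => ?_)
  have h1 := norm_inner_le_norm (𝕜 := ℝ) (A ω) (B ω)
  simp only [Pi.add_apply, ENNReal.toReal_ofNat]
  norm_num
  norm_num at h1
  nlinarith [sq_nonneg (‖A ω‖ - ‖B ω‖), sq_nonneg (‖A ω‖ + ‖B ω‖)]

lemma integral_inner_condExp {Ω : Type*} {m0 : MeasurableSpace Ω} (P : Measure Ω)
    [IsProbabilityMeasure P]
    {E : Type*} [NormedAddCommGroup E] [InnerProductSpace ℝ E] [CompleteSpace E]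
    (m : MeasurableSpace Ω) (hm : m ≤ m0)
    (A G g : Ω → E) (hAm : StronglyMeasurable[m] A) (hA : MemLp A 2 P) (hG : MemLp G 2 P)
    (hGi : Integrable G P)
    (h : P[G | m] =ᵐ[P] g) :
    ∫ ω, ⟪A ω, G ω⟫ ∂P = ∫ ω, ⟪A ω, g ω⟫ ∂P := by
  have hi := integrable_inner_aux P A G hA hG
  have h1 := condExp_bilin_of_stronglyMeasurable_left (m := m) (μ := P) (innerSL ℝ) hAm
    (f := A) (g := G) hi hGi
  rw [← integral_condExp hm (f := fun ω => ⟪A ω, G ω⟫)]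
  refine integral_congr_ae ?_
  filter_upwards [h1, h] with ω h1 h2
  rw [← h2]
  exact h1

/-- Convergence in expectation of SNAG for an `L`-smooth `μ`-strongly convex function
under the strong growth condition with constant `ρ`:
`E[f(x_n) - f*] ≤ 2 (1 - (1/ρ)√(μ/L))^n (f(x_0) - f*)`, and consequently an
`ε`-precision is reached after `ρ√(L/μ) log(2(f(x_0)-f*)/ε)` iterations. -/
theorem stmt14 {Ω : Type*} {m0 : MeasurableSpace Ω} (P : Measure Ω) [IsProbabilityMeasure P]
    {d : ℕ} (f : EuclideanSpace ℝ (Fin d) → ℝ) (L μ ρ : ℝ)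
    (hL : 0 < L) (hμ : 0 < μ) (hμL : μ ≤ L) (hρ : 1 ≤ ρ)
    (hdiff : Differentiable ℝ f)
    (hsmooth : ∀ x y : EuclideanSpace ℝ (Fin d),
      ‖gradient f x - gradient f y‖ ≤ L * ‖x - y‖)
    (hsc : StrongConvexOn Set.univ μ f)
    (xstar : EuclideanSpace ℝ (Fin d)) (hmin : ∀ v, f xstar ≤ f v)
    (F : ℕ → MeasurableSpace Ω) (hF : ∀ n, F n ≤ m0) (hFmono : Monotone F)
    (X Z Y G : ℕ → Ω → EuclideanSpace ℝ (Fin d))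
    (x0 : EuclideanSpace ℝ (Fin d))
    (hX0 : ∀ ω, X 0 ω = x0) (hZ0 : ∀ ω, Z 0 ω = x0)
    (hY : ∀ n ω, Y n ω = (1 + ρ⁻¹ * Real.sqrt (μ / L))⁻¹ • X n ω
        + (1 - (1 + ρ⁻¹ * Real.sqrt (μ / L))⁻¹) • Z n ω)
    (hX : ∀ n ω, X (n + 1) ω = Y n ω - (L * ρ)⁻¹ • G n ω)
    (hZ : ∀ n ω, Z (n + 1) ω = (1 - ρ⁻¹ * Real.sqrt (μ / L)) • Z n ω
        + (ρ⁻¹ * Real.sqrt (μ / L)) • Y n ω - (ρ * Real.sqrt (μ * L))⁻¹ • G n ω)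
    (hadaptX : ∀ n, StronglyMeasurable[F n] (X n))
    (hadaptZ : ∀ n, StronglyMeasurable[F n] (Z n))
    (hintG : ∀ n, Integrable (G n) P)
    (hintG2 : ∀ n, Integrable (fun ω => ‖G n ω‖ ^ 2) P)
    (hintfX : ∀ n, Integrable (fun ω => f (X n ω)) P)
    (hunbiased : ∀ n, P[G n | F n] =ᵐ[P] fun ω => gradient f (Y n ω))
    (hsgc : ∀ n, P[(fun ω => ‖G n ω‖ ^ 2) | F n]
        ≤ᵐ[P] fun ω => ρ * ‖gradient f (Y n ω)‖ ^ 2) :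
    (∀ n : ℕ, ∫ ω, (f (X n ω) - f xstar) ∂P
        ≤ 2 * (1 - ρ⁻¹ * Real.sqrt (μ / L)) ^ n * (f x0 - f xstar)) ∧
    ∀ ε : ℝ, 0 < ε → ∀ n : ℕ,
      ρ * Real.sqrt (L / μ) * Real.log (2 * (f x0 - f xstar) / ε) ≤ (n : ℝ) →
      ∫ ω, (f (X n ω) - f xstar) ∂P ≤ ε := by
  set q : ℝ := ρ⁻¹ * Real.sqrt (μ / L) with hq
  set s : ℝ := (L * ρ)⁻¹ with hs
  set η : ℝ := (ρ * Real.sqrt (μ * L))⁻¹ with hη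
  have hρ0 : 0 < ρ := by linarith
  have hq0 : 0 < q := by positivity
  have hq1 : q ≤ 1 := by
    have h1 : Real.sqrt (μ / L) ≤ 1 := Real.sqrt_le_one.2 ((div_le_one hL).2 hμL)
    have h2 : ρ⁻¹ ≤ 1 := inv_le_one_of_one_le₀ hρ
    exact mul_le_one₀ h2 (Real.sqrt_nonneg _) h1
  have hsm : Real.sqrt μ ^ 2 = μ := Real.sq_sqrt hμ.le
  have hsL : Real.sqrt L ^ 2 = L := Real.sq_sqrt hL.le
  have hsm0 : 0 < Real.sqrt μ := Real.sqrt_pos.2 hμ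
  have hsL0 : 0 < Real.sqrt L := Real.sqrt_pos.2 hL
  have e1 : μ * η = q := by
    rw [hη, hq, Real.sqrt_mul hμ.le, Real.sqrt_div hμ.le]
    field_simp
    exact hsm.symm
  have e2 : μ * η ^ 2 = L * s ^ 2 := by
    rw [hη, hs, inv_pow, mul_pow, Real.sq_sqrt (by positivity)]
    field_simp
  have e3 : s = ρ * (L * s ^ 2) := by
    rw [hs]
    field_simp
  have hgc : Continuous (gradient f) := by
    have : LipschitzWith L.toNNReal (gradient f) := by
      apply LipschitzWith.of_dist_le_mul
      intro x y
      rw [dist_eq_norm, dist_eq_norm, Real.coe_toNNReal _ hL.le]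
      exact hsmooth x y
    exact this.continuous
  have hGm : ∀ n, MemLp (G n) 2 P := fun n =>
    (memLp_two_iff_integrable_sq_norm (hintG n).1).2 (hintG2 n)
  have hYf : ∀ n, Y n = (1 + q)⁻¹ • X n + (1 - (1 + q)⁻¹) • Z n := fun n => funext (hY n)
  have hXZ : ∀ n, MemLp (X n) 2 P ∧ MemLp (Z n) 2 P := by
    intro n
    induction n with
    | zero =>
      rw [show X 0 = fun _ => x0 from funext hX0, show Z 0 = fun _ => x0 from funext hZ0]
      exact ⟨memLp_const _, memLp_const _⟩
    | succ n ih =>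
      have hYn : MemLp (Y n) 2 P := by
        rw [hYf]
        exact (ih.1.const_smul _).add (ih.2.const_smul _)
      rw [show X (n + 1) = Y n - s • G n from funext (hX n),
        show Z (n + 1) = (1 - q) • Z n + q • Y n - η • G n from funext (hZ n)]
      exact ⟨hYn.sub ((hGm n).const_smul _),
        ((ih.2.const_smul _).add (hYn.const_smul _)).sub ((hGm n).const_smul _)⟩
  have hYm : ∀ n, MemLp (Y n) 2 P := fun n => by
    rw [hYf]
    exact ((hXZ n).1.const_smul _).add ((hXZ n).2.const_smul _)
  have hYs : ∀ n, StronglyMeasurable[F n] (Y n) := fun n => by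
    rw [hYf]
    exact ((hadaptX n).const_smul _).add ((hadaptZ n).const_smul _)
  have hgs : ∀ n, StronglyMeasurable[F n] (fun ω => gradient f (Y n ω)) := fun n =>
    hgc.comp_stronglyMeasurable (hYs n)
  have hgm : ∀ n, MemLp (fun ω => gradient f (Y n ω)) 2 P := by
    intro n
    have h1 : MemLp (fun ω => gradient f (Y n ω) - gradient f 0) 2 P := by
      refine MemLp.of_le_mul (c := L) (hYm n) (((hgs n).mono (hF n)).aestronglyMeasurable.sub
        aestronglyMeasurable_const) (Filter.Eventually.of_forall fun ω => ?_)
      simpa using hsmooth (Y n ω) 0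
    have h2 := h1.add (memLp_const (gradient f 0))
    simpa [Pi.add_def] using! h2
  have hzi : ∀ n, Integrable (fun ω => ‖Z n ω - xstar‖ ^ 2) P := fun n => by
    have h1 : MemLp (fun ω => Z n ω - xstar) 2 P := (hXZ n).2.sub (memLp_const xstar)
    exact (memLp_two_iff_integrable_sq_norm h1.1).1 h1
  have hVi : ∀ n, Integrable (fun ω => f (X n ω) - f xstar + μ / 2 * ‖Z n ω - xstar‖ ^ 2) P :=
    fun n => ((hintfX n).sub (integrable_const _)).add ((hzi n).const_mul _)
  have hstep : ∀ n, ∫ ω, (f (X (n + 1) ω) - f xstar + μ / 2 * ‖Z (n + 1) ω - xstar‖ ^ 2) ∂P ≤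
      (1 - q) * ∫ ω, (f (X n ω) - f xstar + μ / 2 * ‖Z n ω - xstar‖ ^ 2) ∂P := by
    intro n
    set A : Ω → EuclideanSpace ℝ (Fin d) := fun ω => -(s • gradient f (Y n ω))
      - q • ((1 - q) • (Z n ω - xstar) + q • (Y n ω - xstar)) with hA
    have hAm : MemLp A 2 P :=
      ((hgm n).const_smul s).neg.sub
        (((((hXZ n).2.sub (memLp_const xstar)).const_smul (1 - q)).add
          (((hYm n).sub (memLp_const xstar)).const_smul q)).const_smul q)
    have hAs : StronglyMeasurable[F n] A :=
      ((hgs n).const_smul s).neg.sub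
        (((((hadaptZ n).sub stronglyMeasurable_const).const_smul (1 - q)).add
          (((hYs n).sub stronglyMeasurable_const).const_smul q)).const_smul q)
    have hI := integral_inner_condExp P (F n) (hF n) A (G n) _ hAs hAm (hGm n) (hintG n)
      (hunbiased n)
    have hi1 := integrable_inner_aux P A (G n) hAm (hGm n)
    have hi2 := integrable_inner_aux P A _ hAm (hgm n)
    have hg2 : Integrable (fun ω => ρ * ‖gradient f (Y n ω)‖ ^ 2) P :=
      ((memLp_two_iff_integrable_sq_norm (hgm n).1).1 (hgm n)).const_mul ρ
    have hJ : ∫ ω, ‖G n ω‖ ^ 2 ∂P ≤ ∫ ω, ρ * ‖gradient f (Y n ω)‖ ^ 2 ∂P := by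
      rw [← integral_condExp (hF n)]
      exact integral_mono_ae integrable_condExp hg2 (hsgc n)
    have hpt : ∀ ω, f (X (n + 1) ω) - f xstar + μ / 2 * ‖Z (n + 1) ω - xstar‖ ^ 2 ≤
        (1 - q) * (f (X n ω) - f xstar + μ / 2 * ‖Z n ω - xstar‖ ^ 2)
        + (⟪A ω, G n ω⟫ - ⟪A ω, gradient f (Y n ω)⟫)
        + L * s ^ 2 * (‖G n ω‖ ^ 2 - ρ * ‖gradient f (Y n ω)‖ ^ 2) := by
      intro ω
      have h1 := descent f L hdiff hsmooth (Y n ω) (-(s • G n ω))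
      have h2 := strong_first f μ hdiff hsc (Y n ω) (X n ω)
      have h3 := strong_first f μ hdiff hsc (Y n ω) xstar
      have hXY : X n ω - Y n ω = -(q • ((Z n ω - xstar) - (Y n ω - xstar))) := by
        have hne : 1 + q ≠ 0 := by positivity
        rw [hY]
        match_scalars <;> field_simp <;> ring
      have h2' : f (Y n ω) + ⟪gradient f (Y n ω), X n ω - Y n ω⟫ ≤ f (X n ω) := by
        have : 0 ≤ μ / 2 * ‖X n ω - Y n ω‖ ^ 2 := by positivity
        linarith
      rw [hXY] at h2'
      rw [← neg_sub (Y n ω) xstar] at h3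
      have h4 := step_ineq _ _ _ _ μ L q s η ρ hμ.le hq0.le hq1 e1 e2 e3 _ _ _ _ h1 h2' h3
      rw [← inner_sub_right]
      have hZ' : Z (n + 1) ω - xstar =
          (1 - q) • (Z n ω - xstar) + q • (Y n ω - xstar) - η • G n ω := by
        rw [hZ]
        module
      rw [hZ', hX, sub_eq_add_neg (Y n ω)]
      exact h4
    have hR1 := (hVi n).const_mul (1 - q)
    have hR2 := hi1.sub hi2
    have hR3 := ((hintG2 n).sub hg2).const_mul (L * s ^ 2)
    have hfin := integral_mono (hVi (n + 1)) ((hR1.add hR2).add hR3) hpt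
    have hsplit := integral_add (hR1.add hR2) hR3
    have hsplit2 := integral_add hR1 hR2
    have hsplit3 := integral_sub hi1 hi2
    have hsplit4 := integral_sub (hintG2 n) hg2
    simp only [Pi.add_apply, Pi.sub_apply, integral_const_mul] at hfin hsplit hsplit2 hsplit3 hsplit4
    have hc : 0 ≤ L * s ^ 2 := by positivity
    rw [integral_const_mul] at hJ
    rw [hsplit, hsplit2, hsplit3, hsplit4, hI] at hfin
    nlinarith [mul_nonneg hc (sub_nonneg.2 hJ)]
  have hg0 : gradient f xstar = 0 := by
    have : IsLocalMin f xstar := Filter.Eventually.of_forall hmin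
    simp [gradient, this.fderiv_eq_zero]
  have hE0 : μ / 2 * ‖x0 - xstar‖ ^ 2 ≤ f x0 - f xstar := by
    have := strong_first f μ hdiff hsc xstar x0
    rw [hg0, inner_zero_left] at this
    linarith
  have hmain : ∀ n : ℕ,
      ∫ ω, (f (X n ω) - f xstar + μ / 2 * ‖Z n ω - xstar‖ ^ 2) ∂P
        ≤ 2 * (1 - q) ^ n * (f x0 - f xstar) := by
    intro n
    induction n with
    | zero =>
      simp only [hX0, hZ0, integral_const, probReal_univ, one_smul, pow_zero]
      linarith
    | succ n ih =>
      refine (hstep n).trans ((mul_le_mul_of_nonneg_left ih (sub_nonneg.2 hq1)).trans_eq ?_)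
      ring
  have hmain' : ∀ n : ℕ, ∫ ω, (f (X n ω) - f xstar) ∂P
        ≤ 2 * (1 - q) ^ n * (f x0 - f xstar) := by
    intro n
    refine le_trans (integral_mono ((hintfX n).sub (integrable_const _)) (hVi n) fun ω => ?_)
      (hmain n)
    have : 0 ≤ μ / 2 * ‖Z n ω - xstar‖ ^ 2 := by positivity
    simp only [Pi.sub_apply]
    linarith
  refine ⟨hmain', fun ε hε n hn => (hmain' n).trans ?_⟩
  have hD : 0 ≤ f x0 - f xstar := sub_nonneg.2 (hmin x0)
  rcases hD.eq_or_lt with h0 | hpos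
  · rw [← h0, mul_zero]
    exact hε.le
  have hqi : ρ * Real.sqrt (L / μ) = q⁻¹ := by
    rw [hq, mul_inv, inv_inv, ← Real.sqrt_inv, inv_div]
  rw [hqi, inv_mul_le_iff₀ hq0] at hn
  have h1 : (1 - q) ^ n ≤ Real.exp (-(q * n)) := by
    have h2 : 1 - q ≤ Real.exp (-q) := by linarith [Real.add_one_le_exp (-q)]
    calc (1 - q) ^ n ≤ Real.exp (-q) ^ n := pow_le_pow_left₀ (sub_nonneg.2 hq1) h2 n
      _ = Real.exp (-(q * n)) := by rw [← Real.exp_nat_mul]; ring_nf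
  have h3 : 2 * (f x0 - f xstar) / ε ≤ Real.exp (q * n) :=
    (Real.log_le_iff_le_exp (by positivity)).1 hn
  rw [div_le_iff₀ hε] at h3
  have h4 : Real.exp (-(q * n)) * Real.exp (q * n) = 1 := by rw [← Real.exp_add]; simp
  calc 2 * (1 - q) ^ n * (f x0 - f xstar) = (1 - q) ^ n * (2 * (f x0 - f xstar)) := by ring
    _ ≤ Real.exp (-(q * n)) * (Real.exp (q * n) * ε) :=
      mul_le_mul h1 h3 (by positivity) (Real.exp_pos _).le
    _ = ε := by rw [← mul_assoc, h4, one_mul]
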